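/- The following four conditions on a geodesic metric space X are equivalent: (i) X is polygon hyperbolic; (ii) there exists δ' ≥ 0 such that (x₀|xₙ)_p ≥ min{(x₀|x₁)_p, …, (xₙ₋₁|xₙ)_p} − δ' for all n ≥ 2 and all x₀,…,xₙ,p ∈ X; (iii) there exists ε ≥ 0 such that for every geodesic ξ and every coterminal continuous path ξ' in X, Im(ξ) is contained in the closed ε-neighborhood of Im(ξ'); (iv) mesh(X) < +∞. -/

import Mathlib

/-- `ξ` is a geodesic defined on the interval `[0, s]`. -/
def IsGeodesicOn {X : Type*} [MetricSpace X] (ξ : ℝ → X) (s : ℝ) : Prop :=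
  0 ≤ s ∧ ∀ a ∈ Set.Icc (0:ℝ) s, ∀ b ∈ Set.Icc (0:ℝ) s, dist (ξ a) (ξ b) = |a - b|

/-- `X` is a geodesic metric space: any two points are joined by a geodesic. -/
def IsGeodesicSpace (X : Type*) [MetricSpace X] : Prop :=
  ∀ x y : X, ∃ (s : ℝ) (ξ : ℝ → X), IsGeodesicOn ξ s ∧ ξ 0 = x ∧ ξ s = y
/-- A geodesic polygon `[[ξ₀, …, ξₙ]]` (an `(n+1)`-gon, `n ≥ 1`): a closed cycle of
`n + 1` geodesics. -/
structure GeodesicPolygon (X : Type*) [MetricSpace X] where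
  n : ℕ
  one_le_n : 1 ≤ n
  s : ℕ → ℝ
  ξ : ℕ → ℝ → X
  geodesic : ∀ i ≤ n, IsGeodesicOn (ξ i) (s i)
  chain : ∀ i < n, ξ i (s i) = ξ (i + 1) 0
  closed : ξ n (s n) = ξ 0 0

/-- The polygon is `δ`-thin: the image of the last side `ξₙ` is contained in the closed
`δ`-neighbourhood of the union of the images of `ξ₀, …, ξₙ₋₁`. -/
def GeodesicPolygon.Thin {X : Type*} [MetricSpace X] (P : GeodesicPolygon X) (δ : ℝ) : Prop :=
  ∀ t ∈ Set.Icc (0:ℝ) (P.s P.n), ∃ j < P.n, ∃ u ∈ Set.Icc (0:ℝ) (P.s j),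
    dist (P.ξ P.n t) (P.ξ j u) ≤ δ

/-- `X` is polygon hyperbolic if some `δ ≥ 0` makes every geodesic polygon `δ`-thin. -/
def PolygonHyperbolic (X : Type*) [MetricSpace X] : Prop :=
  ∃ δ : ℝ, 0 ≤ δ ∧ ∀ P : GeodesicPolygon X, P.Thin δ
/-- `ξ` is a (continuous) path defined on the interval `[0, s]`. -/
def IsPathOn {X : Type*} [MetricSpace X] (ξ : ℝ → X) (s : ℝ) : Prop :=
  0 ≤ s ∧ ContinuousOn ξ (Set.Icc (0:ℝ) s)

/-- A triangle `[[ξ₀, ξ₁, ξ₂]]`: a closed cycle of three continuous paths. -/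
structure Triangle (X : Type*) [MetricSpace X] where
  s : Fin 3 → ℝ
  ξ : Fin 3 → ℝ → X
  path : ∀ i, IsPathOn (ξ i) (s i)
  chain : ∀ i : Fin 3, ξ i (s i) = ξ (i + 1) 0

/-- The mesh of a triangle: the infimum, over choices of a point on each side, of the
diameter of the resulting three-point set. -/
noncomputable def Triangle.mesh {X : Type*} [MetricSpace X] (T : Triangle X) : ℝ :=
  sInf { d : ℝ | ∃ u : Fin 3 → ℝ, (∀ i, u i ∈ Set.Icc (0:ℝ) (T.s i)) ∧
    d = Metric.diam (Set.range fun i => T.ξ i (u i)) }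

/-- The mesh of the space `X`: the supremum of the meshes of all triangles in `X`
(as an extended nonnegative real, so that it may be `+∞`). -/
noncomputable def meshSpace (X : Type*) [MetricSpace X] : ENNReal :=
  ⨆ T : Triangle X, ENNReal.ofReal T.mesh
/-- The Gromov product `(x|y)_p = ½(d(p,x) + d(p,y) − d(x,y))`. -/
noncomputable def gromovProd {X : Type*} [MetricSpace X] (p x y : X) : ℝ :=
  (dist p x + dist p y - dist x y) / 2

theorem IsGeodesicOn.continuousOn {X : Type*} [MetricSpace X] {ξ : ℝ → X} {s : ℝ}
    (h : IsGeodesicOn ξ s) : ContinuousOn ξ (Set.Icc (0 : ℝ) s) := by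
  have : LipschitzOnWith 1 ξ (Set.Icc (0 : ℝ) s) :=
    LipschitzOnWith.of_dist_le_mul fun a ha b hb => by
      rw [h.2 a ha b hb, Real.dist_eq, NNReal.coe_one, one_mul]
  exact this.continuousOn

theorem IsGeodesicOn.isPathOn {X : Type*} [MetricSpace X] {ξ : ℝ → X} {s : ℝ}
    (h : IsGeodesicOn ξ s) : IsPathOn ξ s :=
  ⟨h.1, h.continuousOn⟩

theorem IsGeodesicOn.dist_add_dist {X : Type*} [MetricSpace X] {ξ : ℝ → X} {s t : ℝ}
    (h : IsGeodesicOn ξ s) (ht : t ∈ Set.Icc (0 : ℝ) s) :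
    dist (ξ 0) (ξ t) + dist (ξ t) (ξ s) = dist (ξ 0) (ξ s) := by
  have h0 : (0 : ℝ) ∈ Set.Icc (0 : ℝ) s := ⟨le_rfl, h.1⟩
  have hs : s ∈ Set.Icc (0 : ℝ) s := ⟨h.1, le_rfl⟩
  rw [h.2 0 h0 t ht, h.2 t ht s hs, h.2 0 h0 s hs, abs_of_nonpos (by linarith [ht.1]),
    abs_of_nonpos (by linarith [ht.2]), abs_of_nonpos (by linarith [h.1])]
  ring

theorem IsPathOn.joinedIn {X : Type*} [MetricSpace X] {ξ : ℝ → X} {s : ℝ}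
    (h : IsPathOn ξ s) : JoinedIn (ξ '' Set.Icc (0 : ℝ) s) (ξ 0) (ξ s) := by
  have hmaps : Set.MapsTo (fun t : ℝ => s * t) (Set.Icc 0 1) (Set.Icc 0 s) := fun t ht =>
    ⟨mul_nonneg h.1 ht.1, mul_le_of_le_one_right h.1 ht.2⟩
  refine JoinedIn.ofLine (f := fun t => ξ (s * t)) (h.2.comp (by fun_prop) hmaps)
    (by simp) (by simp) ?_
  rintro _ ⟨t, ht, rfl⟩
  exact ⟨s * t, hmaps ht, rfl⟩

/-- A finite chain of paths joins its initial point to its final point within the union of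
their images. -/
theorem joinedIn_chain {X : Type*} [MetricSpace X] {s : ℕ → ℝ} {ξ : ℕ → ℝ → X} {n : ℕ}
    (hpath : ∀ i ≤ n, IsPathOn (ξ i) (s i)) (hchain : ∀ i < n, ξ i (s i) = ξ (i + 1) 0) :
    JoinedIn (⋃ i ≤ n, ξ i '' Set.Icc (0 : ℝ) (s i)) (ξ 0 0) (ξ n (s n)) := by
  induction n with
  | zero =>
    exact (hpath 0 le_rfl).joinedIn.mono
      (Set.subset_biUnion_of_mem (u := fun i => ξ i '' Set.Icc (0 : ℝ) (s i)) (le_refl 0))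
  | succ n ih =>
    have h₁ := ih (fun i hi => hpath i (by omega)) (fun i hi => hchain i (by omega))
    have h₂ := (hpath (n + 1) le_rfl).joinedIn
    rw [← hchain n (by omega)] at h₂
    refine (h₁.mono ?_).trans (h₂.mono ?_)
    · exact Set.biUnion_subset_biUnion_left fun i (hi : i ≤ n) => Nat.le_succ_of_le hi
    · exact Set.subset_biUnion_of_mem (u := fun i => ξ i '' Set.Icc (0 : ℝ) (s i))
        (le_refl (n + 1))

/-- Points along a path, finely spaced. -/
theorem IsPathOn.exists_subdivision {X : Type*} [MetricSpace X] {ξ : ℝ → X} {s : ℝ}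
    (h : IsPathOn ξ s) {r : ℝ} (hr : 0 < r) :
    ∃ n ≥ 2, ∃ u : ℕ → ℝ, u 0 = 0 ∧ u n = s ∧ (∀ i ≤ n, u i ∈ Set.Icc (0 : ℝ) s) ∧
      ∀ i < n, dist (ξ (u i)) (ξ (u (i + 1))) ≤ r := by
  obtain ⟨η, hη, huc⟩ := Metric.uniformContinuousOn_iff_le.1
    (isCompact_Icc.uniformContinuousOn_of_continuous h.2) r hr
  obtain ⟨N, hN⟩ := exists_nat_gt (s / η)
  have hn : (0 : ℝ) < (N + 2 : ℕ) := by positivity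
  have hmem : ∀ i ≤ N + 2, (i : ℝ) * (s / (N + 2 : ℕ)) ∈ Set.Icc (0 : ℝ) s := fun i hi => by
    refine ⟨mul_nonneg (Nat.cast_nonneg i) (div_nonneg h.1 hn.le), ?_⟩
    have : (i : ℝ) ≤ (N + 2 : ℕ) := by exact_mod_cast hi
    calc (i : ℝ) * (s / (N + 2 : ℕ)) ≤ (N + 2 : ℕ) * (s / (N + 2 : ℕ)) :=
          mul_le_mul_of_nonneg_right this (div_nonneg h.1 hn.le)
      _ = s := mul_div_cancel₀ s hn.ne'
  refine ⟨N + 2, by omega, fun i => i * (s / (N + 2 : ℕ)), by simp,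
    mul_div_cancel₀ s hn.ne', hmem, fun i hi => huc _ (hmem i hi.le) _ (hmem (i + 1) hi) ?_⟩
  have hle : s / (N + 2 : ℕ) ≤ η := by
    rw [div_lt_iff₀ hη] at hN
    rw [div_le_iff₀ hn]
    push_cast
    nlinarith
  rw [Real.dist_eq, abs_sub_comm]
  push_cast at hle ⊢
  rw [show ((i : ℝ) + 1) * (s / (N + 2)) - i * (s / (N + 2)) = s / (N + 2) by ring,
    abs_of_nonneg (div_nonneg h.1 (by positivity))]
  exact hle

theorem gromovProd_le_dist {X : Type*} [MetricSpace X] {ξ : ℝ → X} {s t : ℝ}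
    (h : IsGeodesicOn ξ s) (ht : t ∈ Set.Icc (0 : ℝ) s) (p : X) :
    gromovProd p (ξ 0) (ξ s) ≤ dist p (ξ t) := by
  have := h.dist_add_dist ht
  have := dist_triangle p (ξ t) (ξ 0)
  have := dist_triangle p (ξ t) (ξ s)
  rw [dist_comm (ξ t) (ξ 0)] at *
  unfold gromovProd
  linarith

/-- Every geodesic stays within `ε` of every coterminal path. -/
def PathsFellowGeodesics (X : Type*) [MetricSpace X] (ε : ℝ) : Prop :=
  ∀ (s s' : ℝ) (ξ ξ' : ℝ → X),
    IsGeodesicOn ξ s → IsPathOn ξ' s' → ξ' 0 = ξ 0 → ξ' s' = ξ s →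
    ∀ t ∈ Set.Icc (0 : ℝ) s, ∃ u ∈ Set.Icc (0 : ℝ) s', dist (ξ t) (ξ' u) ≤ ε

theorem PathsFellowGeodesics.of_gromovProd {X : Type*} [MetricSpace X] {δ : ℝ}
    (H : ∀ (n : ℕ) (hn : (Finset.range n).Nonempty), 2 ≤ n → ∀ (x : ℕ → X) (p : X),
      ((Finset.range n).inf' hn fun i => gromovProd p (x i) (x (i + 1))) - δ
        ≤ gromovProd p (x 0) (x n)) :
    PathsFellowGeodesics X (δ + 1) := by
  intro s s' ξ ξ' hξ hξ' h0 hs t ht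
  obtain ⟨n, hn, u, hu0, hun, hu, hstep⟩ := hξ'.exists_subdivision one_pos
  have hne : (Finset.range n).Nonempty := ⟨0, Finset.mem_range.2 (by omega)⟩
  have key := H n hne hn (fun i => ξ' (u i)) (ξ t)
  obtain ⟨i, hi, heq⟩ := Finset.exists_mem_eq_inf' hne
    (fun i => gromovProd (ξ t) (ξ' (u i)) (ξ' (u (i + 1))))
  rw [heq, hu0, hun, h0, hs] at key
  rw [Finset.mem_range] at hi
  have hz : gromovProd (ξ t) (ξ 0) (ξ s) ≤ 0 := by
    simpa using gromovProd_le_dist hξ ht (ξ t)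
  refine ⟨u i, hu i hi.le, ?_⟩
  have h1 := hstep i hi
  have h2 := dist_triangle (ξ t) (ξ' (u (i + 1))) (ξ' (u i))
  rw [dist_comm (ξ' (u (i + 1)))] at h2
  simp only [gromovProd] at key hz
  linarith

theorem PathsFellowGeodesics.of_joinedIn {X : Type*} [MetricSpace X] {ε s t : ℝ}
    (H : PathsFellowGeodesics X ε) {ξ : ℝ → X} {F : Set X} (hξ : IsGeodesicOn ξ s)
    (hF : JoinedIn F (ξ 0) (ξ s)) (ht : t ∈ Set.Icc (0 : ℝ) s) :
    ∃ w ∈ F, dist (ξ t) w ≤ ε := by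
  obtain ⟨γ, hγ⟩ := hF
  obtain ⟨u, hu, hd⟩ := H s 1 ξ γ.extend hξ ⟨zero_le_one, γ.continuous_extend.continuousOn⟩
    (by simp) (by simp) t ht
  rw [γ.extend_apply hu] at hd
  exact ⟨_, hγ ⟨u, hu⟩, hd⟩

theorem PathsFellowGeodesics.thin {X : Type*} [MetricSpace X] {ε : ℝ}
    (H : PathsFellowGeodesics X ε) (P : GeodesicPolygon X) : P.Thin ε := by
  intro t ht
  obtain ⟨m, hm⟩ : ∃ m, P.n = m + 1 := ⟨P.n - 1, by have := P.one_le_n; omega⟩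
  have hj := joinedIn_chain (n := m) (fun i hi => (P.geodesic i (by omega)).isPathOn)
    (fun i hi => P.chain i (by omega))
  rw [← P.closed, P.chain m (by omega), ← hm] at hj
  obtain ⟨w, hw, hd⟩ := H.of_joinedIn (P.geodesic P.n le_rfl) hj.symm ht
  simp only [Set.mem_iUnion] at hw
  obtain ⟨j, hjm, u, hu, rfl⟩ := hw
  exact ⟨j, by omega, u, hu, hd⟩

section ChosenGeodesics

variable {X : Type*} [MetricSpace X] {L : X → X → ℝ} {g : X → X → ℝ → X} {δ : ℝ}

theorem thin_closed_chain
    (hg : ∀ x y, IsGeodesicOn (g x y) (L x y) ∧ g x y 0 = x ∧ g x y (L x y) = y)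
    (hδ : ∀ P : GeodesicPolygon X, P.Thin δ) {n : ℕ} (hn : 1 ≤ n) (x : ℕ → X)
    {z : X} (hz : z ∈ g (x n) (x 0) '' Set.Icc 0 (L (x n) (x 0))) :
    ∃ j < n, ∃ w ∈ g (x j) (x (j + 1)) '' Set.Icc 0 (L (x j) (x (j + 1))), dist z w ≤ δ := by
  let y := Function.update x (n + 1) (x 0)
  have hy : ∀ i ≤ n, y i = x i := fun i hi => Function.update_of_ne (by omega) _ _
  have hyn : y (n + 1) = x 0 := Function.update_self _ _ _
  obtain ⟨t, ht, rfl⟩ := hz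
  obtain ⟨j, hj, u, hu, hd⟩ := hδ
    { n := n
      one_le_n := hn
      s := fun i => L (y i) (y (i + 1))
      ξ := fun i => g (y i) (y (i + 1))
      geodesic := fun i _ => (hg _ _).1
      chain := fun i _ => (hg _ _).2.2.trans (hg _ _).2.1.symm
      closed := by rw [(hg _ _).2.2, (hg _ _).2.1, hyn, hy 0 (by omega)] }
    t (by simpa only [hyn, hy n le_rfl] using ht)
  simp only [hyn, hy n le_rfl] at hd
  have hj' : j < n := hj
  simp only [hy j hj'.le, hy (j + 1) hj'] at hd hu
  exact ⟨j, hj, _, ⟨u, hu, rfl⟩, hd⟩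

/-- In a space with thin triangles, a side of a geodesic triangle has a point close to both
other sides. -/
theorem exists_center
    (hg : ∀ x y, IsGeodesicOn (g x y) (L x y) ∧ g x y 0 = x ∧ g x y (L x y) = y)
    (hδ : ∀ P : GeodesicPolygon X, P.Thin δ) (a b c : X) :
    ∃ z ∈ g c a '' Set.Icc 0 (L c a), ∃ u ∈ g a b '' Set.Icc 0 (L a b),
      ∃ v ∈ g b c '' Set.Icc 0 (L b c), dist z u ≤ δ + 1 ∧ dist z v ≤ δ + 1 := by
  set U := g a b '' Set.Icc 0 (L a b)
  set V := g b c '' Set.Icc 0 (L b c)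
  have haU : a ∈ U := ⟨0, ⟨le_rfl, (hg a b).1.1⟩, (hg a b).2.1⟩
  have hcV : c ∈ V := ⟨L b c, ⟨(hg b c).1.1, le_rfl⟩, (hg b c).2.2⟩
  obtain ⟨hgeo, h0, h1⟩ := hg c a
  obtain ⟨t, ht, heq⟩ := isPreconnected_Icc.intermediate_value₂
    (f := fun t => Metric.infDist (g c a t) V) (g := fun t => Metric.infDist (g c a t) U)
    (Set.left_mem_Icc.2 hgeo.1) (Set.right_mem_Icc.2 hgeo.1)
    ((Metric.continuous_infDist_pt V).comp_continuousOn hgeo.continuousOn)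
    ((Metric.continuous_infDist_pt U).comp_continuousOn hgeo.continuousOn)
    (by simp only [h0, Metric.infDist_zero_of_mem hcV]; exact Metric.infDist_nonneg)
    (by simp only [h1, Metric.infDist_zero_of_mem haU]; exact Metric.infDist_nonneg)
  have hlt : Metric.infDist (g c a t) U < δ + 1 ∧ Metric.infDist (g c a t) V < δ + 1 := by
    obtain ⟨j, hj, w, hw, hd⟩ := thin_closed_chain hg hδ (n := 2) (by omega)
      (fun i => if i = 0 then a else if i = 1 then b else c) (z := g c a t)
      (by simpa using ⟨t, ht, rfl⟩)
    interval_cases j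
    · have := Metric.infDist_le_dist_of_mem (s := U) (x := g c a t) hw
      constructor <;> linarith
    · have := Metric.infDist_le_dist_of_mem (s := V) (x := g c a t) hw
      constructor <;> linarith
  obtain ⟨u, hu, hdu⟩ := (Metric.infDist_lt_iff ⟨a, haU⟩).1 hlt.1
  obtain ⟨v, hv, hdv⟩ := (Metric.infDist_lt_iff ⟨c, hcV⟩).1 hlt.2
  exact ⟨_, ⟨t, ht, rfl⟩, u, hu, v, hv, hdu.le, hdv.le⟩

theorem inf_gromovProd_le_of_thin
    (hg : ∀ x y, IsGeodesicOn (g x y) (L x y) ∧ g x y 0 = x ∧ g x y (L x y) = y)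
    (hδ : ∀ P : GeodesicPolygon X, P.Thin δ) {n : ℕ} (hn : (Finset.range n).Nonempty)
    (x : ℕ → X) (p : X) :
    (Finset.range n).inf' hn (fun i => gromovProd p (x i) (x (i + 1))) - (3 * δ + 2)
      ≤ gromovProd p (x 0) (x n) := by
  obtain ⟨z, hz, _, ⟨tu, htu, rfl⟩, _, ⟨tv, htv, rfl⟩, hdu, hdv⟩ :=
    exists_center hg hδ (x 0) p (x n)
  obtain ⟨j, hj, _, ⟨t, ht, rfl⟩, hd⟩ := thin_closed_chain hg hδ
    (Nat.one_le_iff_ne_zero.2 (Finset.nonempty_range_iff.1 hn)) x hz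
  have hinf := Finset.inf'_le (fun i => gromovProd p (x i) (x (i + 1))) (Finset.mem_range.2 hj)
  have hprod := gromovProd_le_dist (hg (x j) (x (j + 1))).1 ht p
  have hu := (hg (x 0) p).1.dist_add_dist htu
  have hv := (hg p (x n)).1.dist_add_dist htv
  simp only [(hg _ _).2.1, (hg _ _).2.2] at hprod hu hv
  set u := g (x 0) p tu
  set v := g p (x n) tv
  set w := g (x j) (x (j + 1)) t
  have h1 := dist_triangle p z w
  have h2 := dist_triangle_right p z u
  have h3 := dist_triangle (x 0) u z
  have h4 := dist_triangle_right p z v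
  have h5 := dist_triangle z v (x n)
  have hz' : dist (x 0) z + dist z (x n) = dist (x 0) (x n) := by
    obtain ⟨r, hr, rfl⟩ := hz
    have := (hg (x n) (x 0)).1.dist_add_dist hr
    simp only [(hg _ _).2.1, (hg _ _).2.2] at this
    rw [dist_comm (x 0), dist_comm _ (x n), dist_comm (x 0) (x n)]
    linarith
  rw [dist_comm u z] at h3
  rw [dist_comm u p] at hu
  rw [dist_comm (x 0) p] at hu
  simp only [gromovProd] at hinf hprod ⊢
  linarith

theorem PathsFellowGeodesics.mesh_le {ε : ℝ} (hε : 0 ≤ ε)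
    (hg : ∀ x y, IsGeodesicOn (g x y) (L x y) ∧ g x y 0 = x ∧ g x y (L x y) = y)
    (H : PathsFellowGeodesics X ε) (T : Triangle X) : T.mesh ≤ 4 * ε + 2 := by
  obtain ⟨z, hz, u, hu, v, hv, hdu, hdv⟩ :=
    exists_center hg H.thin (T.ξ 0 0) (T.ξ 1 0) (T.ξ 2 0)
  have near : ∀ i : Fin 3, ∀ w ∈ g (T.ξ i 0) (T.ξ (i + 1) 0) ''
      Set.Icc 0 (L (T.ξ i 0) (T.ξ (i + 1) 0)),
      ∃ r ∈ Set.Icc 0 (T.s i), dist w (T.ξ i r) ≤ ε := by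
    rintro i _ ⟨t, ht, rfl⟩
    exact H _ _ _ _ (hg _ _).1 (T.path i) (hg _ _).2.1.symm
      ((T.chain i).trans (hg _ _).2.2.symm) t ht
  have close : ∀ i : Fin 3, ∃ r ∈ Set.Icc 0 (T.s i), dist (T.ξ i r) z ≤ 2 * ε + 1 := by
    have of_near : ∀ i w, w ∈ g (T.ξ i 0) (T.ξ (i + 1) 0) ''
        Set.Icc 0 (L (T.ξ i 0) (T.ξ (i + 1) 0)) → dist z w ≤ ε + 1 →
        ∃ r ∈ Set.Icc 0 (T.s i), dist (T.ξ i r) z ≤ 2 * ε + 1 := by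
      intro i w hw hd
      obtain ⟨r, hr, hrd⟩ := near i w hw
      refine ⟨r, hr, ?_⟩
      have := dist_triangle z w (T.ξ i r)
      rw [dist_comm]
      linarith
    intro i
    fin_cases i
    · exact of_near 0 u hu hdu
    · exact of_near 1 v hv hdv
    · exact of_near 2 z hz (by rw [dist_self]; positivity)
  choose r hr hrd using close
  have hbdd : BddBelow { d : ℝ | ∃ u : Fin 3 → ℝ, (∀ i, u i ∈ Set.Icc (0:ℝ) (T.s i)) ∧
      d = Metric.diam (Set.range fun i => T.ξ i (u i)) } :=
    ⟨0, by rintro _ ⟨_, _, rfl⟩; exact Metric.diam_nonneg⟩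
  calc T.mesh ≤ Metric.diam (Set.range fun i => T.ξ i (r i)) := csInf_le hbdd ⟨r, hr, rfl⟩
    _ ≤ 4 * ε + 2 := ?_
  refine Metric.diam_le_of_forall_dist_le (by positivity) ?_
  rintro _ ⟨i, rfl⟩ _ ⟨j, rfl⟩
  have := dist_triangle_right (T.ξ i (r i)) (T.ξ j (r j)) z
  linarith [hrd i, hrd j]

end ChosenGeodesics

theorem PathsFellowGeodesics.of_mesh_lt {X : Type*} [MetricSpace X] {M : ℝ}
    (H : ∀ T : Triangle X, T.mesh < M) : PathsFellowGeodesics X (2 * M) := by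
  intro s s' ξ ξ' hξ hξ' h0 hs t ht
  let T : Triangle X :=
    { s := ![t, s - t, s']
      ξ := ![ξ, fun a => ξ (t + a), fun a => ξ' (s' - a)]
      path := by
        intro i
        fin_cases i
        · exact ⟨ht.1, hξ.continuousOn.mono (Set.Icc_subset_Icc_right ht.2)⟩
        · exact ⟨sub_nonneg.2 ht.2, hξ.continuousOn.comp (by fun_prop)
            fun a (ha : a ∈ Set.Icc 0 (s - t)) =>
              ⟨by linarith [ha.1, ht.1], by linarith [ha.2]⟩⟩
        · exact ⟨hξ'.1, hξ'.2.comp (by fun_prop)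
            fun a (ha : a ∈ Set.Icc 0 s') => ⟨by linarith [ha.2], by linarith [ha.1]⟩⟩
      chain := by
        intro i
        fin_cases i
        · simp
        · simp [hs]
        · simp [h0] }
  have hne : { d : ℝ | ∃ u : Fin 3 → ℝ, (∀ i, u i ∈ Set.Icc (0:ℝ) (T.s i)) ∧
      d = Metric.diam (Set.range fun i => T.ξ i (u i)) }.Nonempty :=
    ⟨_, fun _ => 0, fun i => ⟨le_rfl, (T.path i).1⟩, rfl⟩
  obtain ⟨_, ⟨u, hu, rfl⟩, hlt⟩ := exists_lt_of_csInf_lt hne (H T)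
  have hd : ∀ i j, dist (T.ξ i (u i)) (T.ξ j (u j)) < M := fun i j =>
    (Metric.dist_le_diam_of_mem (Set.finite_range _).isBounded
      (Set.mem_range_self i) (Set.mem_range_self j)).trans_lt hlt
  have hu0 : u 0 ∈ Set.Icc 0 t := hu 0
  have hu1 : u 1 ∈ Set.Icc 0 (s - t) := hu 1
  have hu2 : u 2 ∈ Set.Icc 0 s' := hu 2
  have h01 : dist (ξ (u 0)) (ξ (t + u 1)) < M := hd 0 1
  have h02 : dist (ξ (u 0)) (ξ' (s' - u 2)) < M := hd 0 2
  have hmem : u 0 ∈ Set.Icc 0 s := ⟨hu0.1, hu0.2.trans ht.2⟩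
  rw [hξ.2 _ hmem _ ⟨by linarith [hu1.1, ht.1], by linarith [hu1.2]⟩, abs_lt] at h01
  have htd : dist (ξ t) (ξ (u 0)) ≤ M := by
    rw [hξ.2 t ht _ hmem, abs_of_nonneg (by linarith [hu0.2])]
    linarith [hu1.1]
  refine ⟨s' - u 2, ⟨by linarith [hu2.2], by linarith [hu2.1]⟩, ?_⟩
  have := dist_triangle (ξ t) (ξ (u 0)) (ξ' (s' - u 2))
  linarith

/-- For a geodesic metric space `X`, the following are equivalent:
(i) `X` is polygon hyperbolic;
(ii) there is `δ' ≥ 0` with `(x₀|xₙ)_p ≥ min{(x₀|x₁)_p, …, (xₙ₋₁|xₙ)_p} − δ'` for all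
`n ≥ 2` and all `x₀, …, xₙ, p ∈ X`;
(iii) there is `ε ≥ 0` such that every geodesic lies in the closed `ε`-neighbourhood
of any coterminal continuous path;
(iv) `mesh(X) < +∞`. -/
theorem polygonHyperbolic_tfae {X : Type*} [MetricSpace X] (hX : IsGeodesicSpace X) :
    List.TFAE
      [PolygonHyperbolic X,
       ∃ δ' : ℝ, 0 ≤ δ' ∧ ∀ (n : ℕ), ∀ _hn : 2 ≤ n, ∀ (x : ℕ → X) (p : X),
         ((Finset.range n).inf' (Finset.nonempty_range_iff.mpr (by omega))
             fun i => gromovProd p (x i) (x (i + 1))) - δ'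
           ≤ gromovProd p (x 0) (x n),
       ∃ ε : ℝ, 0 ≤ ε ∧ ∀ (s s' : ℝ) (ξ ξ' : ℝ → X),
         IsGeodesicOn ξ s → IsPathOn ξ' s' → ξ' 0 = ξ 0 → ξ' s' = ξ s →
         ∀ t ∈ Set.Icc (0:ℝ) s, ∃ u ∈ Set.Icc (0:ℝ) s', dist (ξ t) (ξ' u) ≤ ε,
       meshSpace X ≠ ⊤] := by
  choose L g hg using hX
  tfae_have 1 → 2 := by
    rintro ⟨δ, hδ0, hδ⟩
    exact ⟨3 * δ + 2, by positivity, fun n _ x p => inf_gromovProd_le_of_thin hg hδ _ x p⟩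
  tfae_have 2 → 3 := by
    rintro ⟨δ, hδ0, H⟩
    exact ⟨δ + 1, by positivity, PathsFellowGeodesics.of_gromovProd fun n _ hn => H n hn⟩
  tfae_have 3 → 1 := by
    rintro ⟨ε, hε, H⟩
    exact ⟨ε, hε, PathsFellowGeodesics.thin H⟩
  tfae_have 3 → 4 := by
    rintro ⟨ε, hε, H⟩
    refine ne_top_of_le_ne_top (ENNReal.ofReal_ne_top (r := 4 * ε + 2)) (iSup_le fun T => ?_)
    exact ENNReal.ofReal_le_ofReal (PathsFellowGeodesics.mesh_le hε hg H T)
  tfae_have 4 → 3 := by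
    intro H
    refine ⟨2 * ((meshSpace X).toReal + 1), by positivity,
      PathsFellowGeodesics.of_mesh_lt fun T => ?_⟩
    have hT : T.mesh ≤ (meshSpace X).toReal :=
      (ENNReal.ofReal_le_iff_le_toReal H).1
        (le_iSup (fun T : Triangle X => ENNReal.ofReal T.mesh) T)
    linarith
  tfae_finish
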